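/- arXiv:1002.4907 — 2 statements merged into one kernel-verified Lean document; each statement's English description precedes it below -/
import Mathlib

section
/- Let n ≥ 1 and let p : Fin n → ℝ be a probability vector whose largest probability satisfies max_i p i < 0.4. Then L_yes(p) < H(p) + 1. -/
/-- A probability vector on `Fin n`: nonnegative entries summing to 1. -/
def IsProbVec {n : ℕ} (p : Fin n → ℝ) : Prop :=
  (∀ i, 0 ≤ p i) ∧ ∑ i, p i = 1

/-- A prefix-free binary code: an injective assignment of codewords such that
no codeword is a prefix of another. -/
def IsPrefixFreeCode {n : ℕ} (c : Fin n → List Bool) : Prop :=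
  Function.Injective c ∧ ∀ i j : Fin n, i ≠ j → ¬ (c i <+: c j)

/-- A terminating-yes code: every codeword is nonempty and ends with `true`. -/
def IsTermYes {n : ℕ} (c : Fin n → List Bool) : Prop :=
  ∀ i, c i ≠ [] ∧ (c i).getLast? = some true

/-- Average codeword length of the code `c` under the probability vector `p`. -/
noncomputable def avgLen {n : ℕ} (p : Fin n → ℝ) (c : Fin n → List Bool) : ℝ :=
  ∑ i, p i * ((c i).length : ℝ)

/-- `L_H(p)`: infimum of average lengths over all prefix-free binary codes. -/
noncomputable def LH {n : ℕ} (p : Fin n → ℝ) : ℝ :=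
  sInf {L : ℝ | ∃ c : Fin n → List Bool, IsPrefixFreeCode c ∧ avgLen p c = L}

/-- `L_yes(p)`: infimum of average lengths over all prefix-free terminating-yes codes. -/
noncomputable def Lyes {n : ℕ} (p : Fin n → ℝ) : ℝ :=
  sInf {L : ℝ | ∃ c : Fin n → List Bool,
    IsPrefixFreeCode c ∧ IsTermYes c ∧ avgLen p c = L}

/-- Shannon entropy in bits, with the convention `0 * log₂ 0 = 0`
(automatic since `Real.logb 2 0 = 0`). -/
noncomputable def entropy {n : ℕ} (p : Fin n → ℝ) : ℝ :=
  -∑ i, p i * Real.logb 2 (p i)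

section BinaryCodes

open Finset

/-- The entropy summand `-x log₂ x`. -/
noncomputable def entropyTerm (x : ℝ) : ℝ := -(x * Real.logb 2 x)

theorem entropyTerm_eq_negMulLog_div (x : ℝ) :
    entropyTerm x = Real.negMulLog x / Real.log 2 := by
  simp only [entropyTerm, Real.negMulLog, Real.logb]
  ring

theorem entropyTerm_one : entropyTerm 1 = 0 := by simp [entropyTerm]

theorem entropyTerm_one_half : entropyTerm (1 / 2) = 1 / 2 := by
  simp [entropyTerm, Real.logb_inv]

theorem entropyTerm_mul (s x : ℝ) :
    entropyTerm (s * x) = x * entropyTerm s + s * entropyTerm x := by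
  simp only [entropyTerm_eq_negMulLog_div, Real.negMulLog_mul]
  ring

theorem entropyTerm_add_entropyTerm_one_sub (x : ℝ) :
    entropyTerm x + entropyTerm (1 - x) = Real.binEntropy x / Real.log 2 := by
  rw [entropyTerm_eq_negMulLog_div, entropyTerm_eq_negMulLog_div,
    Real.binEntropy_eq_negMulLog_add_negMulLog_one_sub]
  ring

theorem two_mul_le_entropyTerm_add {x : ℝ} (h0 : 0 ≤ x) (h1 : x ≤ 1 / 2) :
    2 * x ≤ entropyTerm x + entropyTerm (1 - x) := by
  have hl : 0 < Real.log 2 := Real.log_pos (by norm_num)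
  have hc := Real.strictConcave_binEntropy.concaveOn.2
  have h := @hc 0 (by simp) 2⁻¹
    (by constructor <;> norm_num) (1 - 2 * x) (2 * x) (by linarith) (by linarith)
    (by ring)
  have hx : 2 * x * 2⁻¹ = x := by ring
  simp only [smul_eq_mul, mul_zero, zero_add, Real.binEntropy_zero,
    Real.binEntropy_two_inv, hx] at h
  rw [entropyTerm_add_entropyTerm_one_sub, le_div_iff₀ hl]
  exact h

theorem add_half_lt_entropyTerm_add {x : ℝ} (h0 : 1 / 3 ≤ x) (h1 : x < 1 / 2) :
    x + 1 / 2 < entropyTerm x + entropyTerm (1 - x) := by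
  have hl : 0 < Real.log 2 := Real.log_pos (by norm_num)
  have hc := Real.strictConcave_binEntropy.concaveOn.2
  have h := @hc (1 / 3) (by constructor <;> norm_num) 2⁻¹
    (by constructor <;> norm_num) (3 - 6 * x) (6 * x - 2) (by linarith) (by linarith)
    (by ring)
  have hx : (3 - 6 * x) * (1 / 3) + (6 * x - 2) * 2⁻¹ = x := by ring
  have h3 : 5 / 6 * Real.log 2 < Real.binEntropy (1 / 3) := by
    have h98 : Real.log 8 < Real.log 9 := Real.log_lt_log (by norm_num) (by norm_num)
    rw [show (8 : ℝ) = 2 ^ 3 by norm_num, show (9 : ℝ) = 3 ^ 2 by norm_num, Real.log_pow,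
      Real.log_pow] at h98
    rw [Real.binEntropy, show (1 - 1 / 3 : ℝ)⁻¹ = 3 / 2 by norm_num,
      Real.log_div (by norm_num) (by norm_num)]
    norm_num at h98 ⊢
    linarith
  simp only [smul_eq_mul, Real.binEntropy_two_inv, hx] at h
  rw [entropyTerm_add_entropyTerm_one_sub, lt_div_iff₀ hl]
  nlinarith

/-- Merging weights `a ≤ b` yields at least `2a` bits of conditional entropy. -/
theorem two_mul_le_entropyTerm_add_sub {a b : ℝ} (ha : 0 ≤ a) (hab : a ≤ b) :
    2 * a ≤ entropyTerm a + entropyTerm b - entropyTerm (a + b) := by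
  rcases ha.eq_or_lt with rfl | ha'
  · simp [entropyTerm]
  have hs : 0 < a + b := by linarith
  have key := two_mul_le_entropyTerm_add (x := a / (a + b)) (by positivity)
    (by rw [div_le_div_iff₀ hs (by norm_num)]; linarith)
  have e1 := entropyTerm_mul (a + b) (a / (a + b))
  have e2 := entropyTerm_mul (a + b) (1 - a / (a + b))
  have ea : (a + b) * (a / (a + b)) = a := by field_simp
  rw [ea] at e1
  rw [mul_sub, ea, mul_one, add_sub_cancel_left] at e2
  rw [e1, e2]
  have := mul_le_mul_of_nonneg_left key hs.le
  linear_combination this - 2 * ea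

section Clusters

variable {ι : Type*}

/-- There are prefix-free codewords for the symbols in `S`, of cost at most `K`, which end with
`true` once the symbol `b` is put in front of them. -/
def HasYesCode (p : ι → ℝ) (b : Bool) (S : Finset ι) (K : ℝ) : Prop :=
  ∃ c : ι → List Bool, (∀ i ∈ S, ∀ j ∈ S, i ≠ j → ¬ c i <+: c j) ∧
    (∀ i ∈ S, (b :: c i).getLast? = some true) ∧ ∑ i ∈ S, p i * ((c i).length : ℝ) ≤ K

theorem HasYesCode.mono {p : ι → ℝ} {b : Bool} {S : Finset ι} {K K' : ℝ}
    (h : HasYesCode p b S K) (hK : K ≤ K') : HasYesCode p b S K' := by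
  obtain ⟨c, h1, h2, h3⟩ := h
  exact ⟨c, h1, h2, h3.trans hK⟩

theorem HasYesCode.to_true {p : ι → ℝ} {S : Finset ι} {K : ℝ}
    (h : HasYesCode p false S K) : HasYesCode p true S K := by
  obtain ⟨c, h1, h2, h3⟩ := h
  refine ⟨c, h1, fun i hi => ?_, h3⟩
  have := h2 i hi
  cases hc : c i <;> simp_all

theorem HasYesCode.union [DecidableEq ι] {p : ι → ℝ} {S T : Finset ι} {K K' : ℝ} (hd : Disjoint S T)
    (hS : HasYesCode p false S K) (hT : HasYesCode p true T K') :
    HasYesCode p false (S ∪ T) (K + K' + ∑ i ∈ S, p i + ∑ i ∈ T, p i) := by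
  obtain ⟨c, h1, h2, h3⟩ := hS
  obtain ⟨d, k1, k2, k3⟩ := hT
  have hTS : ∀ i ∈ T, i ∉ S := fun i hi hi' => disjoint_left.mp hd hi' hi
  refine ⟨fun i => if i ∈ S then false :: c i else true :: d i, ?_, ?_, ?_⟩
  · intro i hi j hj hij
    by_cases hiS : i ∈ S <;> by_cases hjS : j ∈ S
    · simpa [hiS, hjS, List.cons_prefix_cons] using h1 i hiS j hjS hij
    · simp [hiS, hjS, List.cons_prefix_cons]
    · simp [hiS, hjS, List.cons_prefix_cons]
    · have hiT : i ∈ T := by simpa [hiS] using hi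
      have hjT : j ∈ T := by simpa [hjS] using hj
      simpa [hiS, hjS, List.cons_prefix_cons] using k1 i hiT j hjT hij
  · intro i hi
    by_cases hiS : i ∈ S
    · simpa [hiS, List.getLast?_cons_cons] using h2 i hiS
    · have hiT : i ∈ T := by simpa [hiS] using hi
      simpa [hiS, List.getLast?_cons_cons] using k2 i hiT
  · rw [sum_union hd]
    have e1 : ∑ i ∈ S, p i * (((if i ∈ S then false :: c i else true :: d i).length : ℕ) : ℝ)
        = ∑ i ∈ S, p i * ((c i).length : ℝ) + ∑ i ∈ S, p i := by
      rw [← sum_add_distrib]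
      refine sum_congr rfl fun i hi => ?_
      simp [hi]
      ring
    have e2 : ∑ i ∈ T, p i * (((if i ∈ S then false :: c i else true :: d i).length : ℕ) : ℝ)
        = ∑ i ∈ T, p i * ((d i).length : ℝ) + ∑ i ∈ T, p i := by
      rw [← sum_add_distrib]
      refine sum_congr rfl fun i hi => ?_
      simp [hTS i hi]
      ring
    linarith

/-- The entropy of the cluster `S`, weighted by its total probability. -/
noncomputable def clusterEntropy (p : ι → ℝ) (S : Finset ι) : ℝ :=
  ∑ i ∈ S, entropyTerm (p i) - entropyTerm (∑ i ∈ S, p i)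

/-- `S` has a code of redundancy at most `r`: either a code like that of a single symbol, or a
terminating-yes code whose cost is allowed to grow by half the weight of `S`. -/
def IsCluster (p : ι → ℝ) (S : Finset ι) (r : ℝ) : Prop :=
  (HasYesCode p true S (clusterEntropy p S + r) ∧
    HasYesCode p false S (clusterEntropy p S + r + ∑ i ∈ S, p i)) ∨
  HasYesCode p false S (clusterEntropy p S + r + (∑ i ∈ S, p i) / 2)

theorem isCluster_singleton (p : ι → ℝ) (i : ι) : IsCluster p {i} 0 := by
  left
  refine ⟨⟨fun _ => [], ?_, ?_, ?_⟩, ⟨fun _ => [true], ?_, ?_, ?_⟩⟩ <;>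
    simp [clusterEntropy]

/-- The bound on the redundancy of the union of two clusters of weights `a` and `b`. -/
noncomputable def mergeLoss (a b : ℝ) : ℝ :=
  a + b - (entropyTerm a + entropyTerm b - entropyTerm (a + b))

theorem HasYesCode.of_isCluster_of_isCluster [DecidableEq ι] {p : ι → ℝ} {S T : Finset ι} {r t : ℝ}
    (hd : Disjoint S T) (hS : IsCluster p S r) (hT : IsCluster p T t)
    (h0 : 0 ≤ ∑ i ∈ S, p i) (hle : ∑ i ∈ S, p i ≤ ∑ i ∈ T, p i) :
    HasYesCode p false (S ∪ T) (clusterEntropy p (S ∪ T) +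
      (r + t + mergeLoss (∑ i ∈ S, p i) (∑ i ∈ T, p i)) + (∑ i ∈ S ∪ T, p i) / 2) := by
  have hC : clusterEntropy p (S ∪ T) + mergeLoss (∑ i ∈ S, p i) (∑ i ∈ T, p i)
      = clusterEntropy p S + clusterEntropy p T + ∑ i ∈ S, p i + ∑ i ∈ T, p i := by
    simp only [clusterEntropy, mergeLoss, sum_union hd]
    ring
  have hP : ∑ i ∈ S ∪ T, p i = ∑ i ∈ S, p i + ∑ i ∈ T, p i := sum_union hd
  rcases hS with ⟨hS1, hS⟩ | hS <;> rcases hT with ⟨hT, -⟩ | hT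
  · exact (hS.union hd hT).mono (by linarith)
  · rw [union_comm] at hC hP ⊢
    exact (hT.union hd.symm hS1).mono (by linarith)
  · exact (hS.union hd hT).mono (by linarith)
  · exact (hS.union hd hT.to_true).mono (by linarith)

theorem exists_eq_cons_forall_le {α : Type*} (f : α → ℝ) {M : Multiset α} (hM : M ≠ 0) :
    ∃ a N, M = a ::ₘ N ∧ ∀ x ∈ N, f a ≤ f x := by
  classical
  obtain ⟨a, ha, hmin⟩ := M.toFinset.exists_min_image f
    (by simpa [Finset.nonempty_iff_ne_empty] using hM)
  obtain ⟨N, rfl⟩ := Multiset.exists_cons_of_mem (Multiset.mem_toFinset.mp ha)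
  exact ⟨a, N, rfl, fun x hx => hmin x (by simp [hx])⟩

/-- A stage of Huffman's algorithm: a partition of the symbols into clusters, each listed with a
bound on its redundancy. -/
structure IsForest [Fintype ι] (p : ι → ℝ) (M : Multiset (Finset ι × ℝ)) : Prop where
  cover : (M.map fun x => x.1.val).sum = (univ : Finset ι).val
  isCluster : ∀ x ∈ M, IsCluster p x.1 x.2
  loss_le : ∀ x ∈ M, (M.map Prod.snd).sum ≤ ∑ i ∈ x.1, p i
  balanced : ∀ x ∈ M, ∑ i ∈ x.1, p i < 0.4 ∨ ∀ y ∈ M, ∑ i ∈ x.1, p i ≤ 2 * ∑ i ∈ y.1, p i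

theorem mergeLoss_le {a b : ℝ} (ha : 0 ≤ a) (hab : a ≤ b) : mergeLoss a b ≤ b - a := by
  have := two_mul_le_entropyTerm_add_sub ha hab
  unfold mergeLoss
  linarith

theorem mergeLoss_one_sub_lt {y z : ℝ} (hy : y ≤ z) (hy' : y < 1 / 2) (hz : 1 / 3 ≤ z)
    (hz' : z ≤ 1 / 2) : y + mergeLoss (1 - z) z < 1 / 2 := by
  unfold mergeLoss
  rw [sub_add_cancel, entropyTerm_one]
  rcases hz'.eq_or_lt with rfl | h
  · norm_num [entropyTerm_one_half] at *
    linarith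
  · have := add_half_lt_entropyTerm_add hz h
    linarith

theorem disjoint_of_val_add_le [Fintype ι] {S T : Finset ι} {N : Multiset ι}
    (h : S.val + (T.val + N) = (univ : Finset ι).val) : Disjoint S T := by
  have hn : (S.val + (T.val + N)).Nodup := h ▸ univ.nodup
  have hd := (Multiset.nodup_add.mp hn).2.2
  rw [← Finset.disjoint_val]
  exact hd.mono_right (Multiset.le_add_right _ _)

theorem union_val_of_disjoint [DecidableEq ι] {S T : Finset ι} (h : Disjoint S T) :
    (S ∪ T).val = S.val + T.val := by
  rw [← disjUnion_eq_union _ _ h, disjUnion_val]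

theorem IsForest.merge [Fintype ι] [DecidableEq ι] {p : ι → ℝ} (hp : ∀ i, 0 ≤ p i)
    {a b : Finset ι × ℝ} {M : Multiset (Finset ι × ℝ)} (h : IsForest p (a ::ₘ b ::ₘ M))
    (hab : ∑ i ∈ a.1, p i ≤ ∑ i ∈ b.1, p i)
    (hbM : ∀ x ∈ M, ∑ i ∈ b.1, p i ≤ ∑ i ∈ x.1, p i) :
    IsForest p ((a.1 ∪ b.1,
      a.2 + b.2 + mergeLoss (∑ i ∈ a.1, p i) (∑ i ∈ b.1, p i)) ::ₘ M) := by
  have hcov := h.cover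
  simp only [Multiset.map_cons, Multiset.sum_cons] at hcov
  have hd := disjoint_of_val_add_le hcov
  have ha0 : 0 ≤ ∑ i ∈ a.1, p i := sum_nonneg fun i _ => hp i
  have hsum : ∑ i ∈ a.1 ∪ b.1, p i = ∑ i ∈ a.1, p i + ∑ i ∈ b.1, p i := sum_union hd
  have hml := mergeLoss_le ha0 hab
  have hloss := h.loss_le a (by simp)
  simp only [Multiset.map_cons, Multiset.sum_cons] at hloss
  refine ⟨?_, ?_, ?_, ?_⟩
  · simp only [Multiset.map_cons, Multiset.sum_cons]
    rw [union_val_of_disjoint hd, add_assoc, hcov]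
  · intro x hx
    rcases Multiset.mem_cons.mp hx with rfl | hx
    · exact Or.inr (HasYesCode.of_isCluster_of_isCluster hd (h.isCluster a (by simp))
        (h.isCluster b (by simp)) ha0 hab)
    · exact h.isCluster x (by simp [hx])
  · intro x hx
    simp only [Multiset.map_cons, Multiset.sum_cons]
    rcases Multiset.mem_cons.mp hx with rfl | hx
    · rw [hsum]
      linarith
    · linarith [hbM x hx]
  · intro x hx
    rcases Multiset.mem_cons.mp hx with rfl | hx
    · refine Or.inr fun y hy => ?_
      rcases Multiset.mem_cons.mp hy with rfl | hy
      · simp only [hsum]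
        linarith
      · simp only [hsum]
        linarith [hbM y hy]
    · refine (h.balanced x (by simp [hx])).imp_right fun hb y hy => ?_
      rcases Multiset.mem_cons.mp hy with rfl | hy
      · have := hb a (by simp)
        simp only [hsum]
        linarith
      · exact hb y (by simp [hy])

theorem IsForest.hasYesCode_of_triple [Fintype ι] [DecidableEq ι] {p : ι → ℝ}
    (hp : ∀ i, 0 ≤ p i) (h1 : ∑ i, p i = 1) {a b c : Finset ι × ℝ}
    (h : IsForest p (a ::ₘ b ::ₘ {c})) (hab : ∑ i ∈ a.1, p i ≤ ∑ i ∈ b.1, p i)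
    (hbc : ∑ i ∈ b.1, p i ≤ ∑ i ∈ c.1, p i) :
    ∃ K < ∑ i, entropyTerm (p i) + 1, HasYesCode p false univ K := by
  have hm := h.merge hp hab (by simpa using hbc)
  have hcov := h.cover
  have hcov' := hm.cover
  have hloss := h.loss_le a (by simp)
  simp only [Multiset.map_cons, Multiset.sum_cons, Multiset.map_singleton,
    Multiset.sum_singleton] at hcov hcov' hloss
  have hd := disjoint_of_val_add_le hcov
  have hd' : Disjoint (a.1 ∪ b.1) c.1 :=
    disjoint_of_val_add_le (N := 0) (by simpa using hcov')
  have huniv : a.1 ∪ b.1 ∪ c.1 = univ := by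
    rw [← val_inj, union_val_of_disjoint hd', hcov']
  have hsum : ∑ i ∈ a.1 ∪ b.1, p i = ∑ i ∈ a.1, p i + ∑ i ∈ b.1, p i := sum_union hd
  have htot : ∑ i ∈ a.1, p i + ∑ i ∈ b.1, p i + ∑ i ∈ c.1, p i = 1 := by
    rw [← hsum, ← sum_union hd', huniv, h1]
  have ha0 : 0 ≤ ∑ i ∈ a.1, p i := sum_nonneg fun i _ => hp i
  have hml := mergeLoss_le ha0 hab
  have hbal := h.balanced c (by simp)
  have hc : ∑ i ∈ c.1, p i ≤ 1 / 2 ∧ ∑ i ∈ b.1, p i < 1 / 2 := by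
    rcases hbal with hbal | hbal
    · norm_num at hbal
      constructor <;> linarith
    · have := hbal a (by simp)
      constructor <;> linarith
  have key := mergeLoss_one_sub_lt hbc hc.2 (by linarith) hc.1
  have hwt : ∑ i ∈ a.1 ∪ b.1, p i = 1 - ∑ i ∈ c.1, p i := by linarith
  have hcode := HasYesCode.of_isCluster_of_isCluster hd'.symm (h.isCluster c (by simp))
    (hm.isCluster _ (Multiset.mem_cons_self _ _)) (sum_nonneg fun i _ => hp i)
    (by simp only [hwt]; linarith)
  have hcomm : mergeLoss (∑ i ∈ c.1, p i) (1 - ∑ i ∈ c.1, p i) =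
      mergeLoss (1 - ∑ i ∈ c.1, p i) (∑ i ∈ c.1, p i) := by
    simp only [mergeLoss, add_comm]
  simp only [union_comm c.1, huniv, hwt, hcomm, clusterEntropy, h1, entropyTerm_one] at hcode
  exact ⟨_, by linarith, hcode⟩

theorem IsForest.hasYesCode [Fintype ι] {p : ι → ℝ} (hp : ∀ i, 0 ≤ p i)
    (h1 : ∑ i, p i = 1) (k : ℕ) (M : Multiset (Finset ι × ℝ)) (hk : M.card = k + 3)
    (h : IsForest p M) :
    ∃ K < ∑ i, entropyTerm (p i) + 1, HasYesCode p false univ K := by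
  classical
  induction k generalizing M with
  | zero =>
    obtain ⟨a, N, rfl, ha⟩ := exists_eq_cons_forall_le (fun x => ∑ i ∈ x.1, p i)
      (M := M) (by rintro rfl; simp at hk)
    obtain ⟨b, N, rfl, hb⟩ := exists_eq_cons_forall_le (fun x => ∑ i ∈ x.1, p i)
      (M := N) (by rintro rfl; simp at hk)
    obtain ⟨c, rfl⟩ := Multiset.card_eq_one.mp (by simpa using hk : N.card = 1)
    exact h.hasYesCode_of_triple hp h1 (ha b (by simp)) (hb c (by simp))
  | succ k ih =>
    obtain ⟨a, N, rfl, ha⟩ := exists_eq_cons_forall_le (fun x => ∑ i ∈ x.1, p i)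
      (M := M) (by rintro rfl; simp at hk)
    obtain ⟨b, N, rfl, hb⟩ := exists_eq_cons_forall_le (fun x => ∑ i ∈ x.1, p i)
      (M := N) (by rintro rfl; simp at hk)
    refine ih _ ?_ (h.merge hp (ha b (by simp)) hb)
    simp only [Multiset.card_cons] at hk ⊢
    omega

theorem isForest_singletons [Fintype ι] {p : ι → ℝ} (hp : ∀ i, 0 ≤ p i)
    (hmax : ∀ i, p i < 0.4) :
    IsForest p ((univ : Finset ι).val.map fun i => ({i}, 0)) := by
  refine ⟨?_, ?_, ?_, ?_⟩
  · simp only [Multiset.map_map, Function.comp_def, singleton_val]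
    exact Multiset.sum_map_singleton _
  · intro x hx
    obtain ⟨i, -, rfl⟩ := Multiset.mem_map.mp hx
    exact isCluster_singleton p i
  · intro x hx
    obtain ⟨i, -, rfl⟩ := Multiset.mem_map.mp hx
    simpa using hp i
  · intro x hx
    obtain ⟨i, -, rfl⟩ := Multiset.mem_map.mp hx
    exact Or.inl (by simpa using hmax i)

end Clusters

end BinaryCodes

/-- If the largest probability is below `0.4`, then the optimal terminating-yes
average length is strictly below `H(p) + 1`. -/
theorem Lyes_lt_entropy_add_one_of_max_lt (n : ℕ) (hn : 1 ≤ n) (p : Fin n → ℝ)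
    (hp : IsProbVec p) (hmax : ∀ i, p i < 0.4) :
    Lyes p < entropy p + 1 := by
  obtain ⟨hp0, hp1⟩ := hp
  have hn3 : 3 ≤ n := by
    by_contra! hlt
    have hle : ∑ i, p i ≤ ∑ _i : Fin n, (0.4 : ℝ) :=
      Finset.sum_le_sum fun i _ => (hmax i).le
    have hn2 : (n : ℝ) ≤ 2 := by exact_mod_cast Nat.le_of_lt_succ hlt
    simp only [hp1, Finset.sum_const, Finset.card_univ, Fintype.card_fin, nsmul_eq_mul] at hle
    norm_num at hle
    linarith
  obtain ⟨K, hK, c, hc1, hc2, hc3⟩ := (isForest_singletons hp0 hmax).hasYesCode hp0 hp1 (n - 3) _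
    (by simp; omega)
  have hpre : ∀ i j : Fin n, i ≠ j → ¬ (c i <+: c j) := fun i j =>
    hc1 i (Finset.mem_univ i) j (Finset.mem_univ j)
  have hmem : Lyes p ≤ avgLen p c := by
    refine csInf_le ⟨0, ?_⟩ ⟨c, ⟨fun i j hij => ?_, hpre⟩, fun i => ?_, rfl⟩
    · rintro _ ⟨d, -, -, rfl⟩
      exact Finset.sum_nonneg fun i _ => mul_nonneg (hp0 i) (Nat.cast_nonneg _)
    · by_contra hne
      exact hpre i j hne (hij ▸ List.prefix_refl _)
    · have := hc2 i (Finset.mem_univ i)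
      cases hci : c i <;> simp_all
  have hent : entropy p = ∑ i, entropyTerm (p i) := by
    simp only [entropy, entropyTerm, Finset.sum_neg_distrib]
  rw [hent]
  exact (hmem.trans hc3).trans_lt hK
end

section
/- Let n ≥ 2, let p : Fin n → ℝ be a probability vector with p 0 = p₁ < 1, and let p' : Fin (n−1) → ℝ be the normalized remainder, p' i = p (i+1) / (1 − p₁). Then L_yes(p) ≤ 1 + (1 − p₁) · L_yes(p'): assigning the first object the one-question codeword [true] and prefixing every codeword of an optimal terminating-yes code for p' with false yields a valid prefix-free terminating-yes code for p. -/
/-- Extend a code by the new codeword `[true]`, prefixing all old codewords with `false`. -/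
def extendCode {m : ℕ} (c : Fin m → List Bool) : Fin (m + 1) → List Bool :=
  Fin.cons [true] fun i => false :: c i

lemma IsPrefixFreeCode.extendCode {m : ℕ} {c : Fin m → List Bool} (hc : IsPrefixFreeCode c) :
    IsPrefixFreeCode (extendCode c) := by
  have key : ∀ i j : Fin (m + 1), i ≠ j → ¬ (_root_.extendCode c i <+: _root_.extendCode c j) := by
    intro i j hij
    cases i using Fin.cases <;> cases j using Fin.cases
    · exact absurd rfl hij
    · simp [_root_.extendCode, List.cons_prefix_cons]
    · simp [_root_.extendCode, List.cons_prefix_cons]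
    · rename_i i j
      simpa [_root_.extendCode, List.cons_prefix_cons] using
        hc.2 i j fun h => hij (congrArg Fin.succ h)
  refine ⟨fun i j h => ?_, key⟩
  by_contra hij
  exact key i j hij (h ▸ List.prefix_rfl)

lemma IsTermYes.extendCode {m : ℕ} {c : Fin m → List Bool} (hc : IsTermYes c) :
    IsTermYes (extendCode c) := by
  intro i
  cases i using Fin.cases with
  | zero => simp [_root_.extendCode]
  | succ i => simp [_root_.extendCode, List.getLast?_cons, (hc i).2]

lemma avgLen_extendCode {m : ℕ} (p : Fin (m + 1) → ℝ) (c : Fin m → List Bool) :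
    avgLen p (extendCode c) = ∑ i, p i + avgLen (fun i => p i.succ) c := by
  simp [avgLen, extendCode, Fin.sum_univ_succ, mul_add, Finset.sum_add_distrib]
  ring

lemma exists_isPrefixFreeCode_isTermYes (m : ℕ) :
    ∃ c : Fin m → List Bool, IsPrefixFreeCode c ∧ IsTermYes c := by
  induction m with
  | zero => exact ⟨Fin.elim0, ⟨fun i => i.elim0, fun i => i.elim0⟩, fun i => i.elim0⟩
  | succ m ih =>
    obtain ⟨c, hc, hy⟩ := ih
    exact ⟨extendCode c, hc.extendCode, hy.extendCode⟩

lemma Lyes_le_avgLen {m : ℕ} {p : Fin m → ℝ} (hp : ∀ i, 0 ≤ p i) {c : Fin m → List Bool}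
    (hc : IsPrefixFreeCode c) (hy : IsTermYes c) : Lyes p ≤ avgLen p c := by
  refine csInf_le ⟨0, ?_⟩ ⟨c, hc, hy, rfl⟩
  rintro _ ⟨d, -, -, rfl⟩
  exact Finset.sum_nonneg fun i _ => mul_nonneg (hp i) (Nat.cast_nonneg _)

/-- Conditioning step of the induction: if the first object has the largest
probability `p₁ = p 0 < 1` and `p'` is the normalized remainder, then
`L_yes(p) ≤ 1 + (1 - p₁) · L_yes(p')`. -/
theorem Lyes_le_one_add_conditional (n : ℕ) (hn : 2 ≤ n) (p : Fin n → ℝ)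
    (hp : IsProbVec p) (hmax : ∀ i, p i ≤ p ⟨0, by omega⟩)
    (hp1 : p ⟨0, by omega⟩ < 1)
    (p' : Fin (n - 1) → ℝ)
    (hp' : ∀ i : Fin (n - 1), p' i = p ⟨i.val + 1, by omega⟩ / (1 - p ⟨0, by omega⟩)) :
    Lyes p ≤ 1 + (1 - p ⟨0, by omega⟩) * Lyes p' := by
  obtain ⟨m, rfl⟩ : ∃ m, n = m + 1 := ⟨n - 1, by omega⟩
  have hpos : 0 < 1 - p ⟨0, by omega⟩ := sub_pos.2 hp1
  suffices h : (Lyes p - 1) / (1 - p ⟨0, by omega⟩) ≤ Lyes p' by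
    rw [div_le_iff₀ hpos] at h
    linarith
  obtain ⟨c₀, hc₀, hy₀⟩ := exists_isPrefixFreeCode_isTermYes (m + 1 - 1)
  refine le_csInf ⟨_, c₀, hc₀, hy₀, rfl⟩ ?_
  rintro _ ⟨c, hc, hy, rfl⟩
  have h := Lyes_le_avgLen hp.1 hc.extendCode hy.extendCode
  have hlen : avgLen (fun i : Fin m => p i.succ) c = avgLen p' c * (1 - p ⟨0, by omega⟩) := by
    simp only [avgLen, Finset.sum_mul]
    refine Finset.sum_congr rfl fun i _ => ?_
    rw [hp' i, mul_right_comm, div_mul_cancel₀ _ hpos.ne']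
    rfl
  rw [avgLen_extendCode p c, hp.2, hlen] at h
  rw [div_le_iff₀ hpos]
  linarith
end
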